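/- arXiv:1306.5045 — 10 statements merged into one kernel-verified Lean document; each statement's English description precedes it below -/
import Mathlib

section
/- Let K(x,y) = (x^2 y^2 + x y + x + y)/(x y) for nonzero complex x, y. If a, b, c are nonzero complex numbers satisfying c·b·a = 1 (i.e. (a,b,c) is a trajectory segment of the autonomous mapping w_{n+1} w_n w_{n-1} = 1), then K(c, b) = K(b, a); that is, K is an invariant of the autonomous equation w_{n+1} w_n w_{n-1} = 1. -/
/-- The invariant `K(x,y) = (x²y² + xy + x + y)/(xy)` of the autonomous mapping. -/
noncomputable def Kinv (x y : ℂ) : ℂ := (x ^ 2 * y ^ 2 + x * y + x + y) / (x * y)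

theorem Kinv_eq {x y : ℂ} (hx : x ≠ 0) (hy : y ≠ 0) :
    Kinv x y = x * y + 1 + x⁻¹ + y⁻¹ := by
  unfold Kinv
  field_simp
  ring

/-- If nonzero complex numbers `a, b, c` satisfy `c·b·a = 1` (a trajectory segment of the
autonomous equation `w_{n+1} w_n w_{n-1} = 1`), then `K(c,b) = K(b,a)`: `K` is an invariant. -/
theorem K_invariant (a b c : ℂ) (ha : a ≠ 0) (hb : b ≠ 0) (hc : c ≠ 0)
    (h : c * b * a = 1) : Kinv c b = Kinv b a := by
  have hcb : c * b = a⁻¹ := eq_inv_of_mul_eq_one_left h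
  have hba : c⁻¹ = b * a := inv_eq_of_mul_eq_one_right (by rw [← mul_assoc, h])
  rw [Kinv_eq hc hb, Kinv_eq hb ha, hcb, hba]
  ring
end

section
/- Let q ∈ ℂ∖{0} be such that q^n + 1 + q^{−n} ≠ 0 for every integer n ≥ 1. Then there exists a unique sequence (a_n)_{n≥0} of complex numbers with a_0 = 1 such that for every n ≥ 0, Σ_{(i,j,k,l) ∈ ℕ^4, i+j+k+l = n} q^{l−i} a_i a_j a_k a_l = a_n − δ_{n,1}, where δ_{n,1} = 1 if n = 1 and 0 otherwise. (This sequence gives the formal power series solution w(ξ) = Σ_{n≥0} a_n ξ^{−n}, with w → 1, of q-P1; in particular a_1·(q + 1 + q^{−1}) = −1.) -/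
/-- The coefficient of `ξ⁻ⁿ` in `w(qξ) w(ξ)² w(ξ/q)` for `w(ξ) = Σ aₙ ξ⁻ⁿ`. -/
noncomputable def qP1Coeff (q : ℂ) (a : ℕ → ℂ) (n : ℕ) : ℂ :=
  ∑ i ∈ Finset.range (n + 1), ∑ j ∈ Finset.range (n + 1 - i),
    ∑ k ∈ Finset.range (n + 1 - i - j),
      q ^ (((n - i - j - k : ℕ) : ℤ) - (i : ℤ)) * a i * a j * a k * a (n - i - j - k)

/-- The part of `qP1Coeff` that involves `a n` is linear in it, once `a 0 = 1`. -/
theorem qP1Coeff_eq_add (q : ℂ) {a b : ℕ → ℂ} {n : ℕ} (hn : 1 ≤ n) (h0 : a 0 = 1)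
    (hlt : ∀ m < n, b m = a m) (hb : b n = 0) :
    qP1Coeff q a n =
      (q ^ (n : ℤ) + 2 + q ^ (-(n : ℤ))) * a n + qP1Coeff q b n := by
  have key : ∀ i ∈ Finset.range (n + 1), ∀ j ∈ Finset.range (n + 1 - i),
      ∀ k ∈ Finset.range (n + 1 - i - j),
      q ^ (((n - i - j - k : ℕ) : ℤ) - (i : ℤ)) * a i * a j * a k * a (n - i - j - k) =
        (if i = n then if j = 0 then if k = 0 then q ^ (-(n : ℤ)) * a n else 0 else 0 else 0) +
        (if i = 0 then if j = n then if k = 0 then a n else 0 else 0 else 0) +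
        (if i = 0 then if j = 0 then if k = n then a n else 0 else 0 else 0) +
        (if i = 0 then if j = 0 then if k = 0 then q ^ (n : ℤ) * a n else 0 else 0 else 0) +
        q ^ (((n - i - j - k : ℕ) : ℤ) - (i : ℤ)) * b i * b j * b k * b (n - i - j - k) := by
    intro i hi j hj k hk
    simp only [Finset.mem_range] at hi hj hk
    have hn0 : n ≠ 0 := by omega
    by_cases h1 : i = n
    · obtain ⟨rfl, rfl⟩ : j = 0 ∧ k = 0 := by omega
      subst h1
      simp [h0, hb, hn0]
    by_cases h2 : j = n
    · obtain ⟨rfl, rfl⟩ : i = 0 ∧ k = 0 := by omega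
      subst h2
      simp [h0, hb, hn0, hn0.symm]
    by_cases h3 : k = n
    · obtain ⟨rfl, rfl⟩ : i = 0 ∧ j = 0 := by omega
      subst h3
      simp [h0, hb, hn0, hn0.symm]
    by_cases h4 : n - i - j - k = n
    · obtain ⟨rfl, rfl, rfl⟩ : i = 0 ∧ j = 0 ∧ k = 0 := by omega
      simp [h0, hb, hn0.symm]
    · rw [hlt i (by omega), hlt j (by omega), hlt k (by omega),
        hlt (n - i - j - k) (by omega)]
      have h6 : i = 0 → j = 0 → k ≠ 0 := by omega
      by_cases hi0 : i = 0 <;> by_cases hj0 : j = 0 <;> simp_all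
  unfold qP1Coeff
  rw [Finset.sum_congr rfl fun i hi => Finset.sum_congr rfl fun j hj =>
    Finset.sum_congr rfl fun k hk => key i hi j hj k hk]
  simp only [Finset.sum_add_distrib]
  have e1 : (∑ i ∈ Finset.range (n + 1), ∑ j ∈ Finset.range (n + 1 - i),
      ∑ k ∈ Finset.range (n + 1 - i - j),
      (if i = n then if j = 0 then if k = 0 then q ^ (-(n : ℤ)) * a n else 0 else 0 else 0))
      = q ^ (-(n : ℤ)) * a n := by
    rw [Finset.sum_eq_single_of_mem n (by simp) (by intro i _ hi; simp [hi]),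
      Finset.sum_eq_single_of_mem 0 (by simp) (by intro i _ hi; simp [hi]),
      Finset.sum_eq_single_of_mem 0 (by simp) (by intro i _ hi; simp [hi])]
    simp
  have e (s t : ℕ) (c : ℂ) (hst : s + t ≤ n) : (∑ i ∈ Finset.range (n + 1),
      ∑ j ∈ Finset.range (n + 1 - i), ∑ k ∈ Finset.range (n + 1 - i - j),
      (if i = 0 then if j = s then if k = t then c else 0 else 0 else 0)) = c := by
    rw [Finset.sum_eq_single_of_mem 0 (by simp) (by intro i _ hi; simp [hi]),
      Finset.sum_eq_single_of_mem s (by simp; omega) (by intro i _ hi; simp [hi]),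
      Finset.sum_eq_single_of_mem t (by simp; omega) (by intro i _ hi; simp [hi])]
    simp
  rw [e1, e n 0 _ (by omega), e 0 n _ (by omega), e 0 0 _ (by omega)]
  ring

/-- The coefficients of the formal solution of q-P1 with constant term `1`. -/
noncomputable def qP1Solution (q : ℂ) (n : ℕ) : ℂ :=
  if n = 0 then 1 else
    -((if n = 1 then 1 else 0) + qP1Coeff q (fun m => if _h : m < n then qP1Solution q m else 0) n)
      / (q ^ (n : ℤ) + 1 + q ^ (-(n : ℤ)))
termination_by n

/-- For `n ≥ 1`, the coefficient equation of q-P1 determines `a n` from the earlier ones. -/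
theorem qP1Coeff_eq_iff {q : ℂ} {a : ℕ → ℂ} {n : ℕ} (hn : 1 ≤ n) (h0 : a 0 = 1)
    (hq : q ^ (n : ℤ) + 1 + q ^ (-(n : ℤ)) ≠ 0) :
    qP1Coeff q a n = a n - (if n = 1 then 1 else 0) ↔
      a n = -((if n = 1 then 1 else 0) + qP1Coeff q (fun m => if _h : m < n then a m else 0) n)
        / (q ^ (n : ℤ) + 1 + q ^ (-(n : ℤ))) := by
  rw [qP1Coeff_eq_add q (b := fun m => if _h : m < n then a m else 0) hn h0
    (fun m hm => by simp [hm]) (by simp), eq_div_iff hq]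
  constructor <;> intro h <;> linear_combination h

open Finset in
/-- For `q ≠ 0` with `qⁿ + 1 + q⁻ⁿ ≠ 0` for all `n ≥ 1`, there is a unique sequence
`(aₙ)` with `a₀ = 1` whose members satisfy, for every `n ≥ 0`,
`Σ_{i+j+k+l=n} q^{l−i} a_i a_j a_k a_l = a_n − δ_{n,1}`; this sequence gives the
non-vanishing formal power series solution `w(ξ) = Σ aₙ ξ⁻ⁿ` of q-P1. -/
theorem qP1_nonvanishing_formal_solution (q : ℂ) (hq : q ≠ 0)
    (hq' : ∀ n : ℕ, 1 ≤ n → q ^ (n : ℤ) + 1 + q ^ (-(n : ℤ)) ≠ 0) :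
    ∃! a : ℕ → ℂ, a 0 = 1 ∧ ∀ n : ℕ,
      (∑ i ∈ range (n + 1), ∑ j ∈ range (n + 1 - i), ∑ k ∈ range (n + 1 - i - j),
        q ^ (((n - i - j - k : ℕ) : ℤ) - (i : ℤ)) * a i * a j * a k * a (n - i - j - k)) =
      a n - (if n = 1 then 1 else 0) := by
  have h0 : qP1Solution q 0 = 1 := by rw [qP1Solution]; simp
  have hrec (n : ℕ) (hn : 1 ≤ n) := by
    have := qP1Solution.eq_1 q n
    rwa [if_neg (by omega)] at this
  refine ⟨qP1Solution q, ⟨h0, fun n => ?_⟩, fun a ⟨ha0, ha⟩ => funext fun n => ?_⟩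
  · rcases Nat.eq_zero_or_pos n with rfl | hn
    · simp [h0]
    · exact (qP1Coeff_eq_iff hn h0 (hq' n hn)).2 (hrec n hn)
  · induction n using Nat.strong_induction_on with
    | _ n ih =>
      rcases Nat.eq_zero_or_pos n with rfl | hn
      · rw [ha0, h0]
      · rw [(qP1Coeff_eq_iff hn ha0 (hq' n hn)).1 (ha n), hrec n hn]
        have htrunc : (fun m => if _h : m < n then a m else 0) =
            fun m => if _h : m < n then qP1Solution q m else 0 := by
          funext m
          split_ifs with hm
          exacts [ih m hm, rfl]
        rw [htrunc]
end

section
/- Let q ∈ ℂ∖{0} be such that q^n + 1 + q^{−n} ≠ 0 for every integer n ≥ 1 (this condition is invariant under q ↦ 1/q). Let (a_n(q))_{n≥0} denote the unique sequence with a_0 = 1 satisfying Σ_{i+j+k+l=n} q^{l−i} a_i a_j a_k a_l = a_n − δ_{n,1} for every n ≥ 0, and let (a_n(1/q))_{n≥0} denote the corresponding sequence with q replaced by 1/q. Then a_n(1/q) = a_n(q) for every n ≥ 0; that is, the coefficients of the non-vanishing formal solution of q-P1 are symmetric under q ↦ 1/q. -/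
open PowerSeries in
/-- Products of power series that agree to order `n` agree to order `n`. -/
theorem PowerSeries.X_pow_dvd_mul_sub_mul {R : Type*} [CommRing R] {n : ℕ} {F F' G G' : R⟦X⟧}
    (hF : X ^ n ∣ F - F') (hG : X ^ n ∣ G - G') : X ^ n ∣ F * G - F' * G' := by
  have h : F * G - F' * G' = (F - F') * G + F' * (G - G') := by ring
  rw [h]
  exact dvd_add (hF.mul_right _) (hG.mul_left _)

open PowerSeries in
/-- The `n`-th coefficient of the difference of two products of series with constant term `1`
that agree to order `n` obeys the Leibniz rule. -/
theorem PowerSeries.coeff_mul_sub_mul {R : Type*} [CommRing R] {n : ℕ} {F F' G G' : R⟦X⟧}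
    (hF : X ^ n ∣ F - F') (hG : X ^ n ∣ G - G')
    (hF' : constantCoeff F' = 1) (hG' : constantCoeff G = 1) :
    coeff n (F * G - F' * G') = coeff n (F - F') + coeff n (G - G') := by
  have h : F * G - F' * G' = (F - F') * G + F' * (G - G') := by ring
  obtain ⟨U, hU⟩ := hF
  obtain ⟨V, hV⟩ := hG
  have h' : X ^ n * U * G + F' * (X ^ n * V) = X ^ n * (U * G + F' * V) := by ring
  rw [h, hU, hV, h']
  simp [coeff_X_pow_mul', hF', hG']

open PowerSeries in
/-- The quartic convolution `∑ q ^ (l - i) aᵢ aⱼ aₖ aₗ` over `i + j + k + l = n` is the `n`-th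
coefficient of the product `w(x / q) w(x)² w(q x)`, where `w` generates `a`. -/
theorem sum_zpow_mul_eq_coeff {K : Type*} [Field K] {q : K} (hq : q ≠ 0) (a : ℕ → K) (n : ℕ) :
    (∑ i ∈ Finset.range (n + 1), ∑ j ∈ Finset.range (n + 1 - i),
      ∑ k ∈ Finset.range (n + 1 - i - j),
        q ^ (((n - i - j - k : ℕ) : ℤ) - (i : ℤ)) * a i * a j * a k * a (n - i - j - k)) =
      coeff n ((mk fun m => q⁻¹ ^ m * a m) * (mk fun m => q ^ m * a m) * (mk a * mk a)) := by
  have h : (mk fun m => q⁻¹ ^ m * a m) * (mk fun m => q ^ m * a m) * (mk a * mk a) =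
      (mk fun m => q⁻¹ ^ m * a m) * (mk a * (mk a * mk fun m => q ^ m * a m)) := by ring
  simp only [h, coeff_mul, coeff_mk, Finset.Nat.sum_antidiagonal_eq_sum_range_succ_mk,
    Finset.mul_sum]
  refine Finset.sum_congr rfl fun i hi => ?_
  rw [Finset.mem_range] at hi
  refine Finset.sum_congr (by congr 1; omega) fun j hj => ?_
  rw [Finset.mem_range] at hj
  refine Finset.sum_congr (by congr 1; omega) fun k _ => ?_
  rw [zpow_sub₀ hq, zpow_natCast, zpow_natCast, inv_pow]
  ring

open PowerSeries in
/-- A sequence with constant term `1` is determined by `w(x / q) w(x)² w(q x) - w(x)`. -/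
theorem eq_of_coeff_qP1_eq {K : Type*} [Field K] {q : K}
    (hq : ∀ n : ℕ, 1 ≤ n → q ^ n + 1 + q⁻¹ ^ n ≠ 0) {a b : ℕ → K} (ha : a 0 = 1) (hb : b 0 = 1)
    (h : ∀ n, coeff n ((mk fun m => q⁻¹ ^ m * a m) * (mk fun m => q ^ m * a m) * (mk a * mk a))
        - a n =
      coeff n ((mk fun m => q⁻¹ ^ m * b m) * (mk fun m => q ^ m * b m) * (mk b * mk b)) - b n)
    (n : ℕ) : a n = b n := by
  induction n using Nat.strong_induction_on with
  | _ n ih =>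
    rcases Nat.eq_zero_or_pos n with rfl | hn
    · rw [ha, hb]
    have hdvd (c : ℕ → K) : X ^ n ∣ (mk fun m => c m * a m) - mk fun m => c m * b m := by
      rw [X_pow_dvd_iff]
      intro m hm
      simp [ih m hm]
    have hW : X ^ n ∣ mk a - mk b := by simpa using hdvd 1
    have hconst (f : ℕ → K) : constantCoeff (mk f) = f 0 := by
      rw [← coeff_zero_eq_constantCoeff_apply, coeff_mk]
    have key := coeff_mul_sub_mul
      (X_pow_dvd_mul_sub_mul (hdvd (q⁻¹ ^ ·)) (hdvd (q ^ ·)))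
      (X_pow_dvd_mul_sub_mul hW hW) (by simp [hconst, hb]) (by simp [hconst, ha])
    rw [coeff_mul_sub_mul (hdvd (q⁻¹ ^ ·)) (hdvd (q ^ ·)) (by simp [hconst, hb])
        (by simp [hconst, ha]),
      coeff_mul_sub_mul hW hW (by simp [hconst, hb]) (by simp [hconst, ha])] at key
    simp only [map_sub, coeff_mk] at key
    have hprod : (q ^ n + 1 + q⁻¹ ^ n) * (a n - b n) = 0 := by
      linear_combination h n - key
    exact sub_eq_zero.mp ((mul_eq_zero.mp hprod).resolve_left (hq n hn))

open Finset in
/-- The coefficients of the non-vanishing formal solution of q-P1 are symmetric under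
`q ↦ 1/q`: if `a` is the (unique) sequence with `a₀ = 1` satisfying the defining identities
with parameter `q`, and `a'` is the corresponding sequence with parameter `1/q`, then
`a'ₙ = aₙ` for all `n`. -/
theorem qP1_coefficients_q_inverse_symmetry (q : ℂ) (hq : q ≠ 0)
    (hq' : ∀ n : ℕ, 1 ≤ n → q ^ (n : ℤ) + 1 + q ^ (-(n : ℤ)) ≠ 0)
    (a a' : ℕ → ℂ) (ha0 : a 0 = 1) (ha'0 : a' 0 = 1)
    (ha : ∀ n : ℕ,
      (∑ i ∈ range (n + 1), ∑ j ∈ range (n + 1 - i), ∑ k ∈ range (n + 1 - i - j),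
        q ^ (((n - i - j - k : ℕ) : ℤ) - (i : ℤ)) * a i * a j * a k * a (n - i - j - k)) =
      a n - (if n = 1 then 1 else 0))
    (ha' : ∀ n : ℕ,
      (∑ i ∈ range (n + 1), ∑ j ∈ range (n + 1 - i), ∑ k ∈ range (n + 1 - i - j),
        q⁻¹ ^ (((n - i - j - k : ℕ) : ℤ) - (i : ℤ)) * a' i * a' j * a' k * a' (n - i - j - k)) =
      a' n - (if n = 1 then 1 else 0)) :
    ∀ n : ℕ, a' n = a n := by
  have hqn (n : ℕ) (hn : 1 ≤ n) : q ^ n + 1 + q⁻¹ ^ n ≠ 0 := by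
    simpa using hq' n hn
  refine eq_of_coeff_qP1_eq hqn ha'0 ha0 fun n => ?_
  have h := ha n
  have h' := ha' n
  rw [sum_zpow_mul_eq_coeff hq] at h
  rw [sum_zpow_mul_eq_coeff (inv_ne_zero hq), inv_inv,
    mul_comm (PowerSeries.mk fun m => q ^ m * a' m)] at h'
  rw [h, h']
  ring
end

section
/- Let q ∈ ℂ∖{0}. Define the sequence (b_n)_{n≥1} of complex numbers by b_1 = 1, b_2 = 0, b_3 = 0 and, for n ≥ 4, b_n = Σ_{r=2}^{n−2} Σ_{k=1}^{r−1} Σ_{m=1}^{n−r−1} b_k b_{r−k} b_m b_{n−r−m} q^{r−2k}. Then for every n ≥ 1, Σ_{(i,j,k,l), i,j,k,l ≥ 1, i+j+k+l = n} q^{l−i} b_i b_j b_k b_l = b_n − δ_{n,1}, and moreover (b_n) is the unique sequence of complex numbers indexed by n ≥ 1 satisfying this family of identities. (Equivalently, w(ξ) = Σ_{n≥1} b_n ξ^{−n} is the unique vanishing formal power series solution of q-P1.) -/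
/-- The sum over compositions `n = i + j + k + l`, grouped by `r = i + l`. -/
theorem sum_quadruple_eq_sum_grouped (q : ℂ) (b : ℕ → ℂ) (n : ℕ) :
    (∑ i ∈ Finset.Icc 1 n, ∑ j ∈ Finset.Icc 1 (n - i), ∑ k ∈ Finset.Icc 1 (n - i - j - 1),
        q ^ (((n - i - j - k : ℕ) : ℤ) - (i : ℤ)) * b i * b j * b k * b (n - i - j - k)) =
      ∑ r ∈ Finset.Icc 2 (n - 2), ∑ k ∈ Finset.Icc 1 (r - 1), ∑ m ∈ Finset.Icc 1 (n - r - 1),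
        b k * b (r - k) * b m * b (n - r - m) * q ^ ((r : ℤ) - 2 * (k : ℤ)) := by
  simp only [Finset.sum_sigma']
  refine Finset.sum_bij' (fun x _ => ⟨n - x.2.1 - x.2.2, x.1, x.2.1⟩)
    (fun y _ => ⟨y.2.1, y.2.2, n - y.1 - y.2.2⟩) ?_ ?_ ?_ ?_ ?_
  · rintro ⟨i, j, k⟩ h
    simp only [Finset.mem_sigma, Finset.mem_Icc] at h ⊢
    omega
  · rintro ⟨r, k, m⟩ h
    simp only [Finset.mem_sigma, Finset.mem_Icc] at h ⊢
    omega
  · rintro ⟨i, j, k⟩ h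
    simp only [Finset.mem_sigma, Finset.mem_Icc] at h
    have hk : n - (n - j - k) - j = k := by omega
    simp only [hk]
  · rintro ⟨r, k, m⟩ h
    simp only [Finset.mem_sigma, Finset.mem_Icc] at h
    have hr : n - m - (n - r - m) = r := by omega
    simp only [hr]
  · rintro ⟨i, j, k⟩ h
    simp only [Finset.mem_sigma, Finset.mem_Icc] at h
    have hk : n - (n - j - k) - j = k := by omega
    have hl : n - j - k - i = n - i - j - k := by omega
    have he : ((n - j - k : ℕ) : ℤ) - 2 * (i : ℤ) = ((n - i - j - k : ℕ) : ℤ) - (i : ℤ) := by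
      omega
    simp only [hk, hl, he]
    ring

/-- The sum over compositions of `n` into four parts only involves the terms of index less
than `n`. -/
theorem sum_quadruple_congr (q : ℂ) {b b' : ℕ → ℂ} {n : ℕ}
    (h : ∀ m, 1 ≤ m → m < n → b' m = b m) :
    (∑ i ∈ Finset.Icc 1 n, ∑ j ∈ Finset.Icc 1 (n - i), ∑ k ∈ Finset.Icc 1 (n - i - j - 1),
        q ^ (((n - i - j - k : ℕ) : ℤ) - (i : ℤ)) * b' i * b' j * b' k * b' (n - i - j - k)) =
      ∑ i ∈ Finset.Icc 1 n, ∑ j ∈ Finset.Icc 1 (n - i), ∑ k ∈ Finset.Icc 1 (n - i - j - 1),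
        q ^ (((n - i - j - k : ℕ) : ℤ) - (i : ℤ)) * b i * b j * b k * b (n - i - j - k) := by
  refine Finset.sum_congr rfl fun i hi => Finset.sum_congr rfl fun j hj =>
    Finset.sum_congr rfl fun k hk => ?_
  rw [Finset.mem_Icc] at hi hj hk
  rw [h i (by omega) (by omega), h j (by omega) (by omega), h k (by omega) (by omega),
    h (n - i - j - k) (by omega) (by omega)]

open Finset in
/-- The sequence `(bₙ)` defined by `b₁ = 1`, `b₂ = b₃ = 0` and, for `n ≥ 4`,
`bₙ = Σ_{r=2}^{n−2} Σ_{k=1}^{r−1} Σ_{m=1}^{n−r−1} b_k b_{r−k} b_m b_{n−r−m} q^{r−2k}`,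
satisfies `Σ_{i,j,k,l ≥ 1, i+j+k+l=n} q^{l−i} b_i b_j b_k b_l = bₙ − δ_{n,1}` for every
`n ≥ 1`, and it is the unique sequence (indexed by `n ≥ 1`) with this property:
`w(ξ) = Σ_{n≥1} bₙ ξ⁻ⁿ` is the unique vanishing formal power series solution of q-P1. -/
theorem qP1_vanishing_formal_solution (q : ℂ) (hq : q ≠ 0) (b : ℕ → ℂ)
    (hb1 : b 1 = 1) (hb2 : b 2 = 0) (hb3 : b 3 = 0)
    (hbrec : ∀ n : ℕ, 4 ≤ n →
      b n = ∑ r ∈ Icc 2 (n - 2), ∑ k ∈ Icc 1 (r - 1), ∑ m ∈ Icc 1 (n - r - 1),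
        b k * b (r - k) * b m * b (n - r - m) * q ^ ((r : ℤ) - 2 * (k : ℤ))) :
    (∀ n : ℕ, 1 ≤ n →
      (∑ i ∈ Icc 1 n, ∑ j ∈ Icc 1 (n - i), ∑ k ∈ Icc 1 (n - i - j - 1),
        q ^ (((n - i - j - k : ℕ) : ℤ) - (i : ℤ)) * b i * b j * b k * b (n - i - j - k)) =
      b n - (if n = 1 then 1 else 0)) ∧
    (∀ b' : ℕ → ℂ,
      (∀ n : ℕ, 1 ≤ n →
        (∑ i ∈ Icc 1 n, ∑ j ∈ Icc 1 (n - i), ∑ k ∈ Icc 1 (n - i - j - 1),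
          q ^ (((n - i - j - k : ℕ) : ℤ) - (i : ℤ)) * b' i * b' j * b' k * b' (n - i - j - k)) =
        b' n - (if n = 1 then 1 else 0)) →
      ∀ n : ℕ, 1 ≤ n → b' n = b n) := by
  have hsol : ∀ n : ℕ, 1 ≤ n →
      (∑ i ∈ Icc 1 n, ∑ j ∈ Icc 1 (n - i), ∑ k ∈ Icc 1 (n - i - j - 1),
        q ^ (((n - i - j - k : ℕ) : ℤ) - (i : ℤ)) * b i * b j * b k * b (n - i - j - k)) =
      b n - (if n = 1 then 1 else 0) := by
    intro n hn
    rw [sum_quadruple_eq_sum_grouped]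
    rcases Nat.lt_or_ge n 4 with h | h
    · rw [Icc_eq_empty (by omega : ¬ 2 ≤ n - 2), sum_empty]
      interval_cases n <;> simp [hb1, hb2, hb3]
    · rw [← hbrec n h, if_neg (by omega), sub_zero]
  refine ⟨hsol, fun b' hb' n => ?_⟩
  induction n using Nat.strong_induction_on with
  | _ n ih =>
    intro hn
    have heq := hb' n hn
    rw [sum_quadruple_congr q fun m hm hmn => ih m hmn hm, hsol n hn] at heq
    exact (sub_left_inj.mp heq).symm
end

section
/- Let q ∈ ℂ∖{0} and let (b_n)_{n≥1} be defined by b_1 = 1, b_2 = 0, b_3 = 0 and, for n ≥ 4, b_n = Σ_{r=2}^{n−2} Σ_{k=1}^{r−1} Σ_{m=1}^{n−r−1} b_k b_{r−k} b_m b_{n−r−m} q^{r−2k}. Then for every integer p ≥ 0, b_{3p+2} = 0 and b_{3p+3} = 0; i.e. the only possibly nonzero coefficients are those of index congruent to 1 modulo 3. -/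
open Finset in
/-- For the coefficients `(bₙ)` of the vanishing formal solution of q-P1, defined by
`b₁ = 1`, `b₂ = b₃ = 0` and the convolution recursion for `n ≥ 4`, one has
`b_{3p+2} = 0` and `b_{3p+3} = 0` for every `p ≥ 0`: the only possibly nonzero
coefficients have index congruent to `1` modulo `3`. -/
theorem qP1_vanishing_coefficients_mod_three (q : ℂ) (hq : q ≠ 0) (b : ℕ → ℂ)
    (hb1 : b 1 = 1) (hb2 : b 2 = 0) (hb3 : b 3 = 0)
    (hbrec : ∀ n : ℕ, 4 ≤ n →
      b n = ∑ r ∈ Icc 2 (n - 2), ∑ k ∈ Icc 1 (r - 1), ∑ m ∈ Icc 1 (n - r - 1),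
        b k * b (r - k) * b m * b (n - r - m) * q ^ ((r : ℤ) - 2 * (k : ℤ))) :
    ∀ p : ℕ, b (3 * p + 2) = 0 ∧ b (3 * p + 3) = 0 := by
  have key : ∀ n : ℕ, n ≠ 0 → n % 3 ≠ 1 → b n = 0 := by
    intro n
    induction n using Nat.strong_induction_on with
    | _ n ih =>
      intro hn0 hn
      obtain rfl | rfl | hn4 : n = 2 ∨ n = 3 ∨ 4 ≤ n := by omega
      · exact hb2
      · exact hb3
      · rw [hbrec n hn4]
        refine Finset.sum_eq_zero fun r hr => Finset.sum_eq_zero fun k hk =>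
          Finset.sum_eq_zero fun m hm => ?_
        rw [Finset.mem_Icc] at hr hk hm
        have hmod : k % 3 ≠ 1 ∨ (r - k) % 3 ≠ 1 ∨ m % 3 ≠ 1 ∨ (n - r - m) % 3 ≠ 1 := by
          omega
        rcases hmod with h | h | h | h <;>
          simp [ih _ (by omega) (by omega) h]
  exact fun p => ⟨key _ (by omega) (by omega), key _ (by omega) (by omega)⟩
end

section
/- Let q ∈ ℂ∖{0} and let (b_n)_{n≥1} be defined by b_1 = 1, b_2 = 0, b_3 = 0 and, for n ≥ 4, b_n = Σ_{r=2}^{n−2} Σ_{k=1}^{r−1} Σ_{m=1}^{n−r−1} b_k b_{r−k} b_m b_{n−r−m} q^{r−2k}. Define d_p := b_{3p+1} for p ≥ 0. Then d_0 = 1 and, for every p ≥ 1, d_p = Σ_{i=0}^{p−1} Σ_{j=0}^{i} Σ_{l=0}^{p−1−i} d_j d_{i−j} d_l d_{p−1−i−l} q^{3(i−2j)}. -/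
open Finset in
/-- A sum over `[a, c]` whose terms vanish off the progression `a, a + 3, …` can be restricted to
that progression. -/
theorem sum_Icc_eq_sum_range_three_mul_add {M : Type*} [AddCommMonoid M] (f : ℕ → M)
    (a c N : ℕ) (hN : a + 3 * N = c + 3)
    (hf : ∀ r ∈ Icc a c, r % 3 ≠ a % 3 → f r = 0) :
    ∑ r ∈ Icc a c, f r = ∑ i ∈ range N, f (3 * i + a) := by
  symm
  refine sum_of_injOn (fun i => 3 * i + a) (fun x _ y _ h => ?_) (fun x hx => ?_) (fun r hr h => ?_)
    (fun _ _ => rfl)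
  · simp only at h
    omega
  · simp only [coe_range, Set.mem_Iio] at hx
    simp only [coe_Icc, Set.mem_Icc]
    omega
  · refine hf r hr fun hmod => h ⟨(r - a) / 3, ?_, ?_⟩
    · simp only [mem_Icc] at hr
      simp only [coe_range, Set.mem_Iio]
      omega
    · simp only [mem_Icc] at hr
      simp only
      omega

open Finset in
/-- The coefficients of the vanishing formal solution of q-P1 with index not congruent to `1`
modulo `3` are zero. -/
theorem qP1_coeff_eq_zero_of_mod_three_ne_one (q : ℂ) (b : ℕ → ℂ) (hb2 : b 2 = 0) (hb3 : b 3 = 0)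
    (hbrec : ∀ n : ℕ, 4 ≤ n →
      b n = ∑ r ∈ Icc 2 (n - 2), ∑ k ∈ Icc 1 (r - 1), ∑ m ∈ Icc 1 (n - r - 1),
        b k * b (r - k) * b m * b (n - r - m) * q ^ ((r : ℤ) - 2 * (k : ℤ)))
    (n : ℕ) (hn : 1 ≤ n) (hmod : n % 3 ≠ 1) : b n = 0 := by
  induction n using Nat.strong_induction_on with
  | _ n ih =>
    rcases lt_or_ge n 4 with h4 | h4
    · interval_cases n
      · exact absurd rfl hmod
      · exact hb2
      · exact hb3
    rw [hbrec n h4]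
    refine sum_eq_zero fun r hr => sum_eq_zero fun k hk => sum_eq_zero fun m hm => ?_
    simp only [mem_Icc] at hr hk hm
    by_cases h1 : k % 3 = 1
    · by_cases h2 : (r - k) % 3 = 1
      · by_cases h3 : m % 3 = 1
        · rw [ih (n - r - m) (by omega) (by omega) (by omega)]; ring
        · rw [ih m (by omega) (by omega) h3]; ring
      · rw [ih (r - k) (by omega) (by omega) h2]; ring
    · rw [ih k (by omega) (by omega) h1]; ring


open Finset in
/-- The nonzero coefficients `d_p := b_{3p+1}` of the vanishing formal solution of q-P1
satisfy `d₀ = 1` and, for `p ≥ 1`,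
`d_p = Σ_{i=0}^{p−1} Σ_{j=0}^{i} Σ_{l=0}^{p−1−i} d_j d_{i−j} d_l d_{p−1−i−l} q^{3(i−2j)}`. -/
theorem qP1_staggered_recursion (q : ℂ) (hq : q ≠ 0) (b : ℕ → ℂ)
    (hb1 : b 1 = 1) (hb2 : b 2 = 0) (hb3 : b 3 = 0)
    (hbrec : ∀ n : ℕ, 4 ≤ n →
      b n = ∑ r ∈ Icc 2 (n - 2), ∑ k ∈ Icc 1 (r - 1), ∑ m ∈ Icc 1 (n - r - 1),
        b k * b (r - k) * b m * b (n - r - m) * q ^ ((r : ℤ) - 2 * (k : ℤ)))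
    (d : ℕ → ℂ) (hd : ∀ p : ℕ, d p = b (3 * p + 1)) :
    d 0 = 1 ∧ ∀ p : ℕ, 1 ≤ p →
      d p = ∑ i ∈ range p, ∑ j ∈ range (i + 1), ∑ l ∈ range (p - i),
        d j * d (i - j) * d l * d (p - 1 - i - l) * q ^ (3 * ((i : ℤ) - 2 * (j : ℤ))) := by
  have hz := qP1_coeff_eq_zero_of_mod_three_ne_one q b hb2 hb3 hbrec
  refine ⟨by rw [hd, hb1], fun p hp => ?_⟩
  rw [hd, hbrec _ (by omega), sum_Icc_eq_sum_range_three_mul_add _ 2 _ p (by omega)]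
  · refine sum_congr rfl fun i hi => ?_
    rw [mem_range] at hi
    rw [sum_Icc_eq_sum_range_three_mul_add _ 1 _ (i + 1) (by omega)]
    · refine sum_congr rfl fun j hj => ?_
      rw [mem_range] at hj
      rw [sum_Icc_eq_sum_range_three_mul_add _ 1 _ (p - i) (by omega)]
      · refine sum_congr rfl fun l hl => ?_
        rw [mem_range] at hl
        have h1 : 3 * i + 2 - (3 * j + 1) = 3 * (i - j) + 1 := by omega
        have h2 : 3 * p + 1 - (3 * i + 2) - (3 * l + 1) = 3 * (p - 1 - i - l) + 1 := by omega
        have h3 : ((3 * i + 2 : ℕ) : ℤ) - 2 * ((3 * j + 1 : ℕ) : ℤ) = 3 * ((i : ℤ) - 2 * j) := by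
          push_cast
          ring
        rw [h1, h2, h3, hd, hd, hd, hd]
      · intro m hm hmod
        rw [mem_Icc] at hm
        rw [hz m hm.1 hmod]
        ring
    · intro k hk hmod
      rw [mem_Icc] at hk
      refine sum_eq_zero fun m _ => ?_
      rw [hz k hk.1 hmod]
      ring
  · intro r hr hmod
    refine sum_eq_zero fun k hk => sum_eq_zero fun m _ => ?_
    rw [mem_Icc] at hk
    by_cases h1 : k % 3 = 1
    · rw [hz (r - k) (by omega) (by omega)]
      ring
    · rw [hz k hk.1 h1]
      ring
end

section
/- For q ∈ ℂ∖{0}, let (d_p(q))_{p≥0} be defined by d_0(q) = 1 and, for p ≥ 1, d_p(q) = Σ_{i=0}^{p−1} Σ_{j=0}^{i} Σ_{l=0}^{p−1−i} d_j(q) d_{i−j}(q) d_l(q) d_{p−1−i−l}(q) q^{3(i−2j)}. Then for every p ≥ 0 and every nonzero q, d_p(1/q) = d_p(q); i.e. each d_p is a Laurent polynomial in q symmetric under q ↦ 1/q. -/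
open Finset in
/-- The coefficients `d_p(q)` (defined by `d₀ = 1` and the triple-sum recursion) are
symmetric under `q ↦ 1/q`: if `d` satisfies the recursion with parameter `q` and `d'`
satisfies it with parameter `1/q`, then `d'_p = d_p` for all `p`. -/
theorem qP1_d_coefficients_q_inverse_symmetry (q : ℂ) (hq : q ≠ 0)
    (d d' : ℕ → ℂ) (hd0 : d 0 = 1) (hd'0 : d' 0 = 1)
    (hdrec : ∀ p : ℕ, 1 ≤ p →
      d p = ∑ i ∈ range p, ∑ j ∈ range (i + 1), ∑ l ∈ range (p - i),
        d j * d (i - j) * d l * d (p - 1 - i - l) * q ^ (3 * ((i : ℤ) - 2 * (j : ℤ))))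
    (hd'rec : ∀ p : ℕ, 1 ≤ p →
      d' p = ∑ i ∈ range p, ∑ j ∈ range (i + 1), ∑ l ∈ range (p - i),
        d' j * d' (i - j) * d' l * d' (p - 1 - i - l) * q⁻¹ ^ (3 * ((i : ℤ) - 2 * (j : ℤ)))) :
    ∀ p : ℕ, d' p = d p := by
  intro p
  induction p using Nat.strong_induction_on with
  | _ p ih =>
    rcases Nat.eq_zero_or_pos p with rfl | hp
    · rw [hd0, hd'0]
    rw [hdrec p hp, hd'rec p hp]
    refine sum_congr rfl fun i hi => ?_
    rw [← sum_range_reflect _ (i + 1)]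
    refine sum_congr rfl fun j hj => sum_congr rfl fun l hl => ?_
    rw [mem_range] at hi hj hl
    have hji : i + 1 - 1 - j = i - j := by omega
    have hij : i - (i - j) = j := by omega
    rw [hji, hij, ih (i - j) (by omega), ih j (by omega), ih l (by omega),
      ih (p - 1 - i - l) (by omega), inv_zpow', Nat.cast_sub (by omega : j ≤ i),
      show -(3 * ((i : ℤ) - 2 * ((i : ℤ) - j))) = 3 * ((i : ℤ) - 2 * j) by ring]
    ring
end

section
/- Let q be a real number with q > 1, and let (d_p)_{p≥0} be defined by d_0 = 1 and, for p ≥ 1, d_p = Σ_{i=0}^{p−1} Σ_{j=0}^{i} Σ_{l=0}^{p−1−i} d_j d_{i−j} d_l d_{p−1−i−l} q^{3(i−2j)}. Then d_p ≥ q^{3p(p−1)/2} for every p ≥ 0. Consequently, the formal power series Σ_{p≥0} d_p t^{3p+1} ∈ ℂ[[t]] (equivalently, the series Σ_{n≥1} b_n ξ^{−n}) has radius of convergence 0; that is, the vanishing formal series solution of q-P1 is divergent. -/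
/-- A sequence whose consecutive terms grow at least by the factors `r ^ n`, with `r > 1`,
is the coefficient sequence of a power series that diverges at every nonzero point. -/
theorem not_summable_mul_pow_of_pow_mul_le {r : ℝ} (hr : 1 < r) {d : ℕ → ℝ}
    (hpos : ∀ n, 0 < d n) (hd : ∀ n, r ^ n * d n ≤ d (n + 1)) {t : ℂ} (ht : t ≠ 0) (k m : ℕ) :
    ¬ Summable (fun n : ℕ => (d n : ℂ) * t ^ (k * n + m)) := by
  have hnorm (n : ℕ) : ‖(d n : ℂ) * t ^ (k * n + m)‖ = d n * ‖t‖ ^ (k * n + m) := by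
    rw [norm_mul, norm_pow, Complex.norm_real, Real.norm_of_nonneg (hpos n).le]
  have ht' : 0 < ‖t‖ := norm_pos_iff.mpr ht
  refine not_summable_of_ratio_norm_eventually_ge (r := 2) one_lt_two
    (Filter.Frequently.of_forall fun n => ?_) ?_
  · rw [hnorm]
    have := hpos n
    positivity
  · have hlim : Filter.Tendsto (fun n : ℕ => r ^ n * ‖t‖ ^ k) Filter.atTop Filter.atTop :=
      (tendsto_pow_atTop_atTop_of_one_lt hr).atTop_mul_const (pow_pos ht' k)
    filter_upwards [hlim.eventually_ge_atTop 2] with n hn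
    rw [hnorm, hnorm]
    calc 2 * (d n * ‖t‖ ^ (k * n + m))
        ≤ (r ^ n * ‖t‖ ^ k) * (d n * ‖t‖ ^ (k * n + m)) :=
          mul_le_mul_of_nonneg_right hn (mul_nonneg (hpos n).le (by positivity))
      _ = (r ^ n * d n) * ‖t‖ ^ (k * (n + 1) + m) := by ring
      _ ≤ d (n + 1) * ‖t‖ ^ (k * (n + 1) + m) := by gcongr; exact hd n

open Finset in
/-- For `q > 0` all coefficients of the vanishing formal solution of q-P1 are nonnegative. -/
theorem qP1_coeff_nonneg {q : ℝ} (hq : 0 < q) {d : ℕ → ℝ} (hd0 : d 0 = 1)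
    (hdrec : ∀ p : ℕ, 1 ≤ p →
      d p = ∑ i ∈ range p, ∑ j ∈ range (i + 1), ∑ l ∈ range (p - i),
        d j * d (i - j) * d l * d (p - 1 - i - l) * q ^ (3 * ((i : ℤ) - 2 * (j : ℤ)))) (p : ℕ) :
    0 ≤ d p := by
  induction p using Nat.strong_induction_on with
  | _ p ih =>
    rcases Nat.eq_zero_or_pos p with rfl | hp
    · simp [hd0]
    · rw [hdrec p hp]
      refine sum_nonneg fun i hi => sum_nonneg fun j hj => sum_nonneg fun l hl => ?_
      rw [mem_range] at hi hj hl
      have h1 := ih j (by omega)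
      have h2 := ih (i - j) (by omega)
      have h3 := ih l (by omega)
      have h4 := ih (p - 1 - i - l) (by omega)
      positivity

open Finset in
/-- The term `i = p`, `j = l = 0` of the recurrence bounds `d (p + 1)` from below. -/
theorem qP1_coeff_succ_ge {q : ℝ} (hq : 0 < q) {d : ℕ → ℝ} (hd0 : d 0 = 1)
    (hdrec : ∀ p : ℕ, 1 ≤ p →
      d p = ∑ i ∈ range p, ∑ j ∈ range (i + 1), ∑ l ∈ range (p - i),
        d j * d (i - j) * d l * d (p - 1 - i - l) * q ^ (3 * ((i : ℤ) - 2 * (j : ℤ)))) (p : ℕ) :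
    (q ^ 3) ^ p * d p ≤ d (p + 1) := by
  have hd := qP1_coeff_nonneg hq hd0 hdrec
  have hterm (i j l : ℕ) : 0 ≤ d j * d (i - j) * d l * d (p + 1 - 1 - i - l) *
      q ^ (3 * ((i : ℤ) - 2 * (j : ℤ))) := by
    have h1 := hd j
    have h2 := hd (i - j)
    have h3 := hd l
    have h4 := hd (p + 1 - 1 - i - l)
    positivity
  rw [hdrec (p + 1) (by omega)]
  refine le_trans ?_ (single_le_sum (fun i _ => sum_nonneg fun j _ => sum_nonneg fun l _ =>
    hterm i j l) (mem_range.mpr p.lt_succ_self))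
  refine le_trans ?_ (single_le_sum (fun j _ => sum_nonneg fun l _ => hterm p j l)
    (mem_range.mpr p.succ_pos))
  refine le_trans ?_ (single_le_sum (fun l _ => hterm p 0 l)
    (mem_range.mpr (by omega : 0 < p + 1 - p)))
  have hpow : q ^ (3 * ((p : ℤ) - 2 * ((0 : ℕ) : ℤ))) = (q ^ 3) ^ p := by
    rw [show 3 * ((p : ℤ) - 2 * ((0 : ℕ) : ℤ)) = ((3 * p : ℕ) : ℤ) by push_cast; ring,
      zpow_natCast, pow_mul]
  rw [hpow]
  simp [hd0, mul_comm]


open Finset in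
/-- For real `q > 1`, the coefficients `d_p` of the vanishing formal solution of q-P1
satisfy `d_p ≥ q^{3p(p−1)/2}`; consequently the formal power series `Σ_p d_p t^{3p+1}`
(equivalently `Σ_n b_n ξ⁻ⁿ`) has radius of convergence `0`, i.e. it diverges (is not
summable) for every nonzero `t`. -/
theorem qP1_vanishing_series_divergent (q : ℝ) (hq : 1 < q)
    (d : ℕ → ℝ) (hd0 : d 0 = 1)
    (hdrec : ∀ p : ℕ, 1 ≤ p →
      d p = ∑ i ∈ range p, ∑ j ∈ range (i + 1), ∑ l ∈ range (p - i),
        d j * d (i - j) * d l * d (p - 1 - i - l) * q ^ (3 * ((i : ℤ) - 2 * (j : ℤ)))) :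
    (∀ p : ℕ, q ^ (3 * p * (p - 1) / 2) ≤ d p) ∧
    (∀ t : ℂ, t ≠ 0 → ¬ Summable (fun p : ℕ => (d p : ℂ) * t ^ (3 * p + 1))) := by
  have hq0 : 0 < q := by linarith
  have hsucc := qP1_coeff_succ_ge hq0 hd0 hdrec
  have hlow (p : ℕ) : q ^ (3 * p * (p - 1) / 2) ≤ d p := by
    induction p with
    | zero => simp [hd0]
    | succ p ih =>
      have hexp : 3 * (p + 1) * (p + 1 - 1) / 2 = 3 * p + 3 * p * (p - 1) / 2 := by
        have h : 3 * (p + 1) * (p + 1 - 1) = 3 * p * (p - 1) + 3 * p * 2 := by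
          cases p <;> simp; ring
        rw [h, Nat.add_mul_div_right _ _ two_pos, add_comm]
      rw [hexp, pow_add, pow_mul]
      exact (mul_le_mul_of_nonneg_left ih (by positivity)).trans (hsucc p)
  exact ⟨hlow, fun t ht => not_summable_mul_pow_of_pow_mul_le
    (one_lt_pow₀ hq three_ne_zero) (fun p => (pow_pos hq0 _).trans_le (hlow p)) hsucc ht 3 1⟩
end

section
/- For integers i, j, l, p define D(i,j,l,p) = j(j−1) + (i−j)(i−j−1) + 2(i−2j) + l(l−1) + (p−1−i−l)(p−1−i−l−1). Then for every integer p ≥ 3: (a) for every integer j with 1 ≤ j ≤ p−2, D(p−1, j, 0, p) − p(p−1) ≤ −2p; (b) for every integer l with 1 ≤ l ≤ p−2, D(0, 0, l, p) − p(p−1) ≤ −4p + 6; and (c) for all integers i, j, l with 1 ≤ i ≤ p−2, 0 ≤ j ≤ i and 0 ≤ l ≤ p−1−i, D(i, j, l, p) − p(p−1) ≤ −2p + 2. -/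
/-- The quadratic exponent function `D(i,j,l,p)` arising from the rescaled recursion for the
coefficients of the vanishing formal solution of q-P1. -/
def Dexp (i j l p : ℤ) : ℤ :=
  j * (j - 1) + (i - j) * (i - j - 1) + 2 * (i - 2 * j) + l * (l - 1) +
    (p - 1 - i - l) * (p - 1 - i - l - 1)

/-- Estimates on the exponent function `D`: for every `p ≥ 3`,
(a) `D(p−1, j, 0, p) − p(p−1) ≤ −2p` for `1 ≤ j ≤ p−2`;
(b) `D(0, 0, l, p) − p(p−1) ≤ −4p + 6` for `1 ≤ l ≤ p−2`;
(c) `D(i, j, l, p) − p(p−1) ≤ −2p + 2` for `1 ≤ i ≤ p−2`, `0 ≤ j ≤ i`, `0 ≤ l ≤ p−1−i`. -/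
theorem Dexp_estimates (p : ℤ) (hp : 3 ≤ p) :
    (∀ j : ℤ, 1 ≤ j → j ≤ p - 2 → Dexp (p - 1) j 0 p - p * (p - 1) ≤ -2 * p) ∧
    (∀ l : ℤ, 1 ≤ l → l ≤ p - 2 → Dexp 0 0 l p - p * (p - 1) ≤ -4 * p + 6) ∧
    (∀ i j l : ℤ, 1 ≤ i → i ≤ p - 2 → 0 ≤ j → j ≤ i → 0 ≤ l → l ≤ p - 1 - i →
      Dexp i j l p - p * (p - 1) ≤ -2 * p + 2) := by
  simp only [Dexp]
  refine ⟨fun j h₁ h₂ => ?_, fun l h₁ h₂ => ?_, fun i j l hi hip hj hji hl hlp => ?_⟩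
  · have h := mul_nonneg (sub_nonneg.2 h₁) (show 0 ≤ p - j by lia)
    linear_combination 2 * h
  · have h := mul_nonneg (sub_nonneg.2 h₁) (sub_nonneg.2 h₂)
    linear_combination 2 * h
  · have hj' := mul_nonneg hj (sub_nonneg.2 hji)
    have hl' := mul_nonneg hl (sub_nonneg.2 hlp)
    have hi' := mul_nonneg (zero_le_one.trans hi) (sub_nonneg.2 hip)
    linear_combination 2 * hj' + 2 * hl' + 2 * hi' + 4 * hj
end

section
/- Let (W_n), (P_n), (v_n), (R_n) be sequences of complex numbers with W_n ≠ 0 and P_n ≠ 0 for all n, such that P_{n+1} + (2 W_{n+1}/W_n − 1/(W_n^2 W_{n−1})) P_n + (W_{n+1}/W_{n−1}) P_{n−1} = 0 and v_{n+1} + (2 W_{n+1}/W_n − 1/(W_n^2 W_{n−1})) v_n + (W_{n+1}/W_{n−1}) v_{n−1} = R_n for all n in the relevant range. Fix an integer n_0. Then every such solution (v_n) satisfies the summation equation: for all n ≥ n_0, v_n = P_n · [ v_{n_0}/P_{n_0} + Σ_{j=n_0+1}^{n} (W_j W_{j−1})/(P_j P_{j−1}) · ( g_{n_0} + Σ_{k=n_0}^{j−1}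 P_k R_k/(W_{k+1} W_k) ) ], where g_{n_0} = (P_{n_0−1} v_{n_0} − P_{n_0} v_{n_0−1})/(W_{n_0} W_{n_0−1}) and empty sums are zero. -/
open Finset in
/-- Telescoping over integer intervals: a sequence is recovered from its backward differences. -/
theorem eq_add_sum_Icc_of_backward_difference {M : Type*} [AddCommMonoid M] {f d : ℤ → M}
    (h : ∀ m : ℤ, f (m + 1) = f m + d (m + 1)) {a n : ℤ} (han : a ≤ n) :
    f n = f a + ∑ j ∈ Icc (a + 1) n, d j := by
  induction n, han using Int.leInduction with
  | base => simp
  | succ n hn ih =>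
    have hI : Icc (a + 1) (n + 1) = insert (n + 1) (Icc (a + 1) n) := by
      ext x
      simp only [mem_Icc, mem_insert]
      omega
    rw [hI, sum_insert (by simp), h, ih, add_assoc, add_comm (d (n + 1))]

open Finset in
/-- Telescoping over integer intervals: a sequence is recovered from its forward differences. -/
theorem eq_add_sum_Icc_of_forward_difference {M : Type*} [AddCommMonoid M] {f d : ℤ → M}
    (h : ∀ m : ℤ, f (m + 1) = f m + d m) {a n : ℤ} (han : a ≤ n) :
    f n = f a + ∑ k ∈ Icc a (n - 1), d k := by
  induction n, han using Int.leInduction with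
  | base => simp
  | succ n hn ih =>
    have hI : Icc a (n + 1 - 1) = insert n (Icc a (n - 1)) := by
      ext x
      simp only [mem_Icc, mem_insert]
      omega
    rw [hI, sum_insert (by simp), h, ih, add_assoc, add_comm (d n)]

open Finset in
/-- Summation (discrete Duhamel) equation for solutions of the linearised q-P1 equation:
if `P` (nowhere zero) solves the linear homogeneous equation and `v` solves the
inhomogeneous equation with right-hand side `R`, then for every `n ≥ n₀`,
`v_n = P_n ( v_{n₀}/P_{n₀} + Σ_{j=n₀+1}^{n} (W_j W_{j−1})/(P_j P_{j−1})
( g_{n₀} + Σ_{k=n₀}^{j−1} P_k R_k/(W_{k+1} W_k) ) )`, where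
`g_{n₀} = (P_{n₀−1} v_{n₀} − P_{n₀} v_{n₀−1})/(W_{n₀} W_{n₀−1})`. -/
theorem qP1_summation_equation
    (W P v R : ℤ → ℂ) (hW : ∀ n : ℤ, W n ≠ 0) (hPne : ∀ n : ℤ, P n ≠ 0)
    (hP : ∀ n : ℤ, P (n + 1) +
      (2 * W (n + 1) / W n - 1 / ((W n) ^ 2 * W (n - 1))) * P n +
      (W (n + 1) / W (n - 1)) * P (n - 1) = 0)
    (hv : ∀ n : ℤ, v (n + 1) +
      (2 * W (n + 1) / W n - 1 / ((W n) ^ 2 * W (n - 1))) * v n +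
      (W (n + 1) / W (n - 1)) * v (n - 1) = R n)
    (n₀ : ℤ) :
    ∀ n : ℤ, n₀ ≤ n →
      v n = P n * (v n₀ / P n₀ +
        ∑ j ∈ Icc (n₀ + 1) n, (W j * W (j - 1)) / (P j * P (j - 1)) *
          ((P (n₀ - 1) * v n₀ - P n₀ * v (n₀ - 1)) / (W n₀ * W (n₀ - 1)) +
            ∑ k ∈ Icc n₀ (j - 1), P k * R k / (W (k + 1) * W k))) := by
  intro n hn
  have hg : ∀ m : ℤ, (P (m + 1 - 1) * v (m + 1) - P (m + 1) * v (m + 1 - 1)) /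
      (W (m + 1) * W (m + 1 - 1)) =
      (P (m - 1) * v m - P m * v (m - 1)) / (W m * W (m - 1)) +
        P m * R m / (W (m + 1) * W m) := by
    intro m
    have h₀ := hW m
    have h₁ := hW (m + 1)
    have h₂ := hW (m - 1)
    have hc : P m * v (m + 1) - P (m + 1) * v m =
        P m * R m + W (m + 1) / W (m - 1) * (P (m - 1) * v m - P m * v (m - 1)) := by
      linear_combination P m * hv m - v m * hP m
    rw [add_sub_cancel_right, hc]
    field_simp
    ring
  have hu : ∀ m : ℤ, v (m + 1) / P (m + 1) = v m / P m +
      (W (m + 1) * W (m + 1 - 1)) / (P (m + 1) * P (m + 1 - 1)) *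
        ((P (m + 1 - 1) * v (m + 1) - P (m + 1) * v (m + 1 - 1)) /
          (W (m + 1) * W (m + 1 - 1))) := by
    intro m
    have h₀ := hW m
    have h₁ := hW (m + 1)
    have h₂ := hPne m
    have h₃ := hPne (m + 1)
    rw [add_sub_cancel_right]
    field_simp
    ring
  rw [mul_comm, ← div_eq_iff (hPne n)]
  refine (eq_add_sum_Icc_of_backward_difference (f := fun m => v m / P m)
    (d := fun m => (W m * W (m - 1)) / (P m * P (m - 1)) *
      ((P (m - 1) * v m - P m * v (m - 1)) / (W m * W (m - 1)))) hu hn).trans ?_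
  congr 1
  refine sum_congr rfl fun j hj => ?_
  have hj' : n₀ ≤ j := by
    have := (mem_Icc.mp hj).1
    omega
  exact congrArg _ (eq_add_sum_Icc_of_forward_difference
    (f := fun m => (P (m - 1) * v m - P m * v (m - 1)) / (W m * W (m - 1))) hg hj')
end
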